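/- Let F be the field with four elements with a fixed generator ω of its multiplicative group, and let h be the standard hermitian form on F³ given by h(x,y) = x₀y₀² + x₁y₁² + x₂y₂². Let a, u ∈ F³ with a ≠ 0, h(a,a) = 0, h(a,u) = 0, and u not an F-scalar multiple of a. Then the GF(2)-span of {a, ω•a, u} inside F³ (regarded as a vector space over ZMod 2) is a 3-dimensional GF(2)-subspace on which the alternating form s(x,y) = h(x,y) + h(y,x) vanishes identically, i.e. it is a totally isotropic plane of the associated 6-dimensional symplectic GF(2)-space. -/

import Mathlib

/-- The standard hermitian form `h(x,y) = x₀·y₀² + x₁·y₁² + x₂·y₂²` on `F³`, where `F` is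
the field with four elements (conjugation being the Frobenius `y ↦ y²`). -/
noncomputable def herm (x y : Fin 3 → GaloisField 2 2) : GaloisField 2 2 :=
  ∑ i : Fin 3, x i * (y i) ^ 2

theorem herm_add_left (x y z : Fin 3 → GaloisField 2 2) :
    herm (x + y) z = herm x z + herm y z := by
  simp [herm, add_mul, Finset.sum_add_distrib]

theorem herm_add_right (x y z : Fin 3 → GaloisField 2 2) :
    herm x (y + z) = herm x y + herm x z := by
  simp [herm, CharTwo.add_sq, mul_add, Finset.sum_add_distrib]

theorem herm_smul_left (c : GaloisField 2 2) (x y : Fin 3 → GaloisField 2 2) :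
    herm (c • x) y = c * herm x y := by
  simp [herm, Finset.mul_sum, mul_assoc]

theorem herm_smul_right (c : GaloisField 2 2) (x y : Fin 3 → GaloisField 2 2) :
    herm x (c • y) = c ^ 2 * herm x y := by
  simp only [herm, Finset.mul_sum, Pi.smul_apply, smul_eq_mul]
  exact Finset.sum_congr rfl fun i _ => by ring

theorem gf4_card : Nat.card (GaloisField 2 2) = 4 := by
  rw [GaloisField.card 2 2 (by norm_num)]; norm_num

theorem gf4_pow_four (x : GaloisField 2 2) : x ^ 4 = x := by
  have : Fintype (GaloisField 2 2) := Fintype.ofFinite _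
  have h := FiniteField.pow_card x
  rwa [← Nat.card_eq_fintype_card, gf4_card] at h

theorem herm_swap (x y : Fin 3 → GaloisField 2 2) : herm y x = herm x y ^ 2 := by
  simp only [herm, Fin.sum_univ_three, CharTwo.add_sq, mul_pow, ← pow_mul]
  norm_num [gf4_pow_four, mul_comm]

theorem zmod_two_cases (c : ZMod 2) : c = 0 ∨ c = 1 := by
  revert c; decide

theorem gf4_gen_ne_one (ω : (GaloisField 2 2)ˣ)
    (hω : ∀ z : (GaloisField 2 2)ˣ, z ∈ Subgroup.zpowers ω) :
    (ω : GaloisField 2 2) ≠ 1 := by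
  intro h
  have h1 : ω = 1 := Units.ext h
  subst h1
  have h3 : Nat.card (GaloisField 2 2)ˣ = 3 := by
    rw [Nat.card_units, gf4_card]
  have h4 : Subsingleton (GaloisField 2 2)ˣ := by
    refine ⟨fun x y => ?_⟩
    have hx := hω x
    have hy := hω y
    simp at hx hy
    rw [hx, hy]
  have := Finite.card_le_one_iff_subsingleton.mpr h4
  omega

/-- Let `ω` be a generator of the multiplicative group of `GF(4)`, `a` a nonzero isotropic
vector of `GF(4)³` and `u` a vector orthogonal to `a` that is not a `GF(4)`-multiple of
`a`.  Then the `GF(2)`-span of `{a, ω•a, u}` is a 3-dimensional `GF(2)`-subspace on which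
the alternating form `s(x,y) = h(x,y) + h(y,x)` vanishes identically, i.e. a totally
isotropic plane of the associated 6-dimensional symplectic `GF(2)`-space. -/
theorem span_is_totally_isotropic_plane
    (ω : (GaloisField 2 2)ˣ) (hω : ∀ z : (GaloisField 2 2)ˣ, z ∈ Subgroup.zpowers ω)
    (a u : Fin 3 → GaloisField 2 2) (ha0 : a ≠ 0)
    (ha : herm a a = 0) (hau : herm a u = 0)
    (hu : ∀ α : GaloisField 2 2, u ≠ α • a) :
    Module.finrank (ZMod 2)
      (Submodule.span (ZMod 2) {a, (ω : GaloisField 2 2) • a, u}) = 3 ∧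
    ∀ x ∈ Submodule.span (ZMod 2) {a, (ω : GaloisField 2 2) • a, u},
      ∀ y ∈ Submodule.span (ZMod 2) {a, (ω : GaloisField 2 2) • a, u},
        herm x y + herm y x = 0 := by
  constructor
  · have hω1 := gf4_gen_ne_one ω hω
    have hω0 : (ω : GaloisField 2 2) ≠ 0 := ω.ne_zero
    have hli : LinearIndependent (ZMod 2) ![a, (ω : GaloisField 2 2) • a, u] := by
      rw [Fintype.linearIndependent_iff]
      intro g hg
      simp only [Fin.sum_univ_three, Matrix.cons_val_zero, Matrix.cons_val_one,
        Matrix.cons_val] at hg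
      have h00 := hu 0
      have h01 := hu 1
      have h02 := hu ω
      have h03 := hu (1 + ω)
      have hωa : (ω : GaloisField 2 2) • a ≠ 0 := smul_ne_zero hω0 ha0
      have hω1a : (1 + ω : GaloisField 2 2) • a ≠ 0 :=
        smul_ne_zero (fun h => hω1 (CharTwo.add_eq_zero.mp h).symm) ha0
      have key : ∀ v w : Fin 3 → GaloisField 2 2, v + w = 0 → w = v := by
        intro v w h
        funext i
        exact (CharTwo.add_eq_zero.mp (congrFun h i)).symm
      rw [add_smul, one_smul] at h03 hω1a
      rw [one_smul] at h01
      rw [zero_smul] at h00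
      rcases zmod_two_cases (g 0) with h0 | h0 <;> rcases zmod_two_cases (g 1) with h1 | h1 <;>
        rcases zmod_two_cases (g 2) with h2 | h2 <;>
        simp only [h0, h1, h2, zero_smul, one_smul, zero_add, add_zero] at hg
      · intro i; fin_cases i <;> assumption
      · exact absurd hg h00
      · exact absurd hg hωa
      · exact absurd (key _ _ hg) h02
      · exact absurd hg ha0
      · exact absurd (key _ _ hg) h01
      · exact absurd hg hω1a
      · exact absurd (key _ _ hg) h03
    have := finrank_span_eq_card hli
    have hr : Set.range ![a, (ω : GaloisField 2 2) • a, u] = {a, (ω : GaloisField 2 2) • a, u} := by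
      rw [Matrix.range_cons, Matrix.range_cons, Matrix.range_cons, Matrix.range_empty,
        Set.union_empty]
      rfl
    rw [hr, Fintype.card_fin] at this
    exact this
  · have hua : herm u a = 0 := by rw [herm_swap a u, hau]; simp
    have hz : ∀ x, herm 0 x = 0 := fun x => by simp [herm]
    have hz' : ∀ x, herm x 0 = 0 := fun x => by simp [herm]
    intro x hx y hy
    induction hx, hy using Submodule.span_induction₂ with
    | mem_mem x y hx hy =>
      simp only [Set.mem_insert_iff, Set.mem_singleton_iff] at hx hy
      rcases hx with rfl | rfl | rfl <;> rcases hy with rfl | rfl | rfl <;>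
        simp [herm_smul_left, herm_smul_right, ha, hau, hua, CharTwo.add_self_eq_zero]
    | zero_left y hy => simp [hz, hz']
    | zero_right x hx => simp [hz, hz']
    | add_left x y z hx hy hz h1 h2 =>
      rw [herm_add_left, herm_add_right]
      linear_combination h1 + h2
    | add_right x y z hx hy hz h1 h2 =>
      rw [herm_add_left, herm_add_right]
      linear_combination h1 + h2
    | smul_left r x y hx hy h =>
      rcases zmod_two_cases r with rfl | rfl
      · simp [hz, hz']
      · simpa using h
    | smul_right r x y hx hy h =>
      rcases zmod_two_cases r with rfl | rfl
      · simp [hz, hz']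
      · simpa using h
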